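/- arXiv:1909.03468 — 2 statements merged into one kernel-verified Lean document; each statement's English description precedes it below -/
import Mathlib

section
/- Let g ≥ 2. In the presented group G_g = ⟨c_1, …, c_{2g} ∣ c_1c_2⋯c_{2g} = c_{2g}⋯c_2c_1⟩, for every i with 2 ≤ i ≤ 2g the following two identities hold: c_i⁻¹c_{i+1}⁻¹⋯c_{2g}⁻¹·c_1c_2⋯c_{i−1} = c_{i−1}c_{i−2}⋯c_1·c_{2g}⁻¹c_{2g−1}⁻¹⋯c_i⁻¹, and c_{i−1}⁻¹c_{i−2}⁻¹⋯c_1⁻¹·c_{2g}c_{2g−1}⋯c_i = c_ic_{i+1}⋯c_{2g}·c_1⁻¹c_2⁻¹⋯c_{i−1}⁻¹. -/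
/-- The relator `c_1 c_2 ⋯ c_{2g} (c_{2g} ⋯ c_2 c_1)⁻¹` in the free group on `Fin (2*g)`
(the generator `c_k`, `1 ≤ k ≤ 2g`, corresponds to the index `k - 1`). -/
def surfaceRel (g : ℕ) : FreeGroup (Fin (2 * g)) :=
  (List.ofFn fun i : Fin (2 * g) => FreeGroup.of i).prod *
    ((List.ofFn fun i : Fin (2 * g) => FreeGroup.of i).reverse.prod)⁻¹

/-- The presented group `G_g = ⟨c_1, …, c_{2g} ∣ c_1 c_2 ⋯ c_{2g} = c_{2g} ⋯ c_2 c_1⟩`. -/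
abbrev SurfaceGroup (g : ℕ) : Type := PresentedGroup {surfaceRel g}

/-- The generator `c_k` of `G_g`, with the 1-based index `k` (for `1 ≤ k ≤ 2g`). -/
def cgen (g : ℕ) (k : ℕ) : SurfaceGroup g :=
  if h : k - 1 < 2 * g then PresentedGroup.of (⟨k - 1, h⟩ : Fin (2 * g)) else 1

/-- The ascending product `c_a c_{a+1} ⋯ c_b` in `G_g`. -/
def cUp (g a b : ℕ) : SurfaceGroup g :=
  ((List.range' a (b + 1 - a)).map (cgen g)).prod

/-- The descending product `c_b c_{b-1} ⋯ c_a` in `G_g`. -/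
def cDown (g a b : ℕ) : SurfaceGroup g :=
  ((List.range' a (b + 1 - a)).reverse.map (cgen g)).prod

/-- The ascending product of inverses `c_a⁻¹ c_{a+1}⁻¹ ⋯ c_b⁻¹` in `G_g`. -/
def cUpInv (g a b : ℕ) : SurfaceGroup g :=
  ((List.range' a (b + 1 - a)).map fun k => (cgen g k)⁻¹).prod

/-- The descending product of inverses `c_b⁻¹ c_{b-1}⁻¹ ⋯ c_a⁻¹` in `G_g`. -/
def cDownInv (g a b : ℕ) : SurfaceGroup g :=
  ((List.range' a (b + 1 - a)).reverse.map fun k => (cgen g k)⁻¹).prod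


theorem cUpInv_eq_inv_cDown (g a b : ℕ) : cUpInv g a b = (cDown g a b)⁻¹ := by
  simp [cUpInv, cDown, List.prod_inv_reverse, Function.comp_def]

theorem cDownInv_eq_inv_cUp (g a b : ℕ) : cDownInv g a b = (cUp g a b)⁻¹ := by
  simp [cDownInv, cUp, List.prod_inv_reverse, Function.comp_def]

/-- Splitting the interval `[1, n]` into `[1, i - 1]` and `[i, n]`. -/
theorem range'_one_eq_append {i n : ℕ} (hi : 1 ≤ i) (hin : i ≤ n) :
    List.range' 1 n = List.range' 1 (i - 1 + 1 - 1) ++ List.range' i (n + 1 - i) := by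
  obtain ⟨j, rfl⟩ := Nat.exists_eq_add_of_le' hi
  obtain ⟨k, rfl⟩ := Nat.exists_eq_add_of_le hin
  rw [show j + 1 + k = j + (k + 1) by omega, ← List.range'_append]
  congr 2 <;> omega

theorem map_cgen_range' (g : ℕ) :
    (List.range' 1 (2 * g)).map (cgen g) =
      List.ofFn fun i : Fin (2 * g) => (PresentedGroup.of i : SurfaceGroup g) := by
  apply List.ext_getElem
  · simp
  · intro k hk _
    have hk' : k < 2 * g := by simpa using hk
    simp [cgen, hk']

/-- The defining relation `c_1 ⋯ c_{2g} = c_{2g} ⋯ c_1`. -/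
theorem prod_map_cgen_eq_prod_reverse (g : ℕ) :
    ((List.range' 1 (2 * g)).map (cgen g)).prod =
      ((List.range' 1 (2 * g)).reverse.map (cgen g)).prod := by
  have h : PresentedGroup.mk {surfaceRel g} (surfaceRel g) = 1 :=
    PresentedGroup.one_of_mem (Set.mem_singleton _)
  rw [surfaceRel, map_mul, map_inv, mul_inv_eq_one, map_list_prod, map_list_prod,
    List.map_reverse, List.map_ofFn] at h
  rw [List.map_reverse, map_cgen_range']
  exact h

theorem cUp_mul_cUp_eq_cDown_mul_cDown {g i : ℕ} (hi : 1 ≤ i) (hig : i ≤ 2 * g) :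
    cUp g 1 (i - 1) * cUp g i (2 * g) = cDown g i (2 * g) * cDown g 1 (i - 1) := by
  have h := prod_map_cgen_eq_prod_reverse g
  rwa [range'_one_eq_append hi hig, List.reverse_append, List.map_append, List.map_append,
    List.prod_append, List.prod_append] at h

/-- In `G_g = ⟨c_1, …, c_{2g} ∣ c_1⋯c_{2g} = c_{2g}⋯c_1⟩` (`g ≥ 2`), for `2 ≤ i ≤ 2g` one has
`c_i⁻¹c_{i+1}⁻¹⋯c_{2g}⁻¹ c_1⋯c_{i−1} = c_{i−1}⋯c_1 c_{2g}⁻¹⋯c_i⁻¹` and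
`c_{i−1}⁻¹⋯c_1⁻¹ c_{2g}⋯c_i = c_i⋯c_{2g} c_1⁻¹⋯c_{i−1}⁻¹`. -/
theorem statement_2 (g : ℕ) (hg : 2 ≤ g) (i : ℕ) (hi1 : 2 ≤ i) (hi2 : i ≤ 2 * g) :
    cUpInv g i (2 * g) * cUp g 1 (i - 1) = cDown g 1 (i - 1) * cDownInv g i (2 * g) ∧
    cDownInv g 1 (i - 1) * cDown g i (2 * g) = cUp g i (2 * g) * cUpInv g 1 (i - 1) := by
  have h := cUp_mul_cUp_eq_cDown_mul_cDown (g := g) (by omega : 1 ≤ i) hi2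
  rw [cUpInv_eq_inv_cDown, cDownInv_eq_inv_cUp, cDownInv_eq_inv_cUp, cUpInv_eq_inv_cDown]
  constructor
  · rw [inv_mul_eq_iff_eq_mul, ← mul_assoc, eq_mul_inv_iff_mul_eq, h]
  · rw [inv_mul_eq_iff_eq_mul, ← mul_assoc, eq_mul_inv_iff_mul_eq, h]
end

section
/- Let g ≥ 2 and let K be a field. Let D ⊆ A be the set consisting of: (1) x_j·(x_{j−1}⋯x_1·y_{2g}⋯y_{j+1})^s·y_j − (y_{j+1}⋯y_{2g}·x_1⋯x_{j−1})^s for 2 ≤ j ≤ 2g and s ≥ 1; (2) x_j·(x_{j+1}⋯x_{2g}·y_1⋯y_{j−1})^s·y_j − (y_{j−1}⋯y_1·x_{2g}⋯x_{j+1})^s for 2 ≤ j ≤ 2g and s ≥ 1; (3) y_{2g}y_{2g−1}⋯y_1 − y_1y_2⋯y_{2g}; (4) x_1x_2⋯x_{2g} − x_{2g}x_{2g−1}⋯x_1; (5) y_iy_{i+1}⋯y_{2g}·x_1⋯x_{i−1} − x_{i−1}⋯x_1·y_{2g}⋯y_i for 2 ≤ i ≤ 2g; (6) y_{i−1}⋯y_1·x_{2g}⋯x_i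 − x_i⋯x_{2g}·y_1⋯y_{i−1} for 2 ≤ i ≤ 2g; (7) y_ix_i − 1 for 1 ≤ i ≤ 2g; (8) x_iy_i − 1 for 1 ≤ i ≤ 2g. Then the two-sided ideal of A generated by D equals the ideal I. -/
variable (K : Type*) [Field K]

/-- The free associative `K`-algebra `A = K⟨x_1, y_1, …, x_{2g}, y_{2g}⟩` on `4g`
noncommuting generators: `Sum.inl i` is `x_{i+1}` (standing for `c_{i+1}`) and
`Sum.inr i` is `y_{i+1}` (standing for `c_{i+1}⁻¹`). -/
abbrev SurfAlg (g : ℕ) : Type _ := FreeAlgebra K (Fin (2 * g) ⊕ Fin (2 * g))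

/-- The generator `x_k` (1-based index `k`, for `1 ≤ k ≤ 2g`). -/
noncomputable def xg (g k : ℕ) : SurfAlg K g :=
  if h : k - 1 < 2 * g then FreeAlgebra.ι K (Sum.inl (⟨k - 1, h⟩ : Fin (2 * g))) else 0

/-- The generator `y_k` (1-based index `k`, for `1 ≤ k ≤ 2g`). -/
noncomputable def yg (g k : ℕ) : SurfAlg K g :=
  if h : k - 1 < 2 * g then FreeAlgebra.ι K (Sum.inr (⟨k - 1, h⟩ : Fin (2 * g))) else 0

/-- The ascending word `x_a x_{a+1} ⋯ x_b`. -/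
noncomputable def xUp (g a b : ℕ) : SurfAlg K g :=
  ((List.range' a (b + 1 - a)).map (xg K g)).prod

/-- The descending word `x_b x_{b-1} ⋯ x_a`. -/
noncomputable def xDown (g a b : ℕ) : SurfAlg K g :=
  ((List.range' a (b + 1 - a)).reverse.map (xg K g)).prod

/-- The ascending word `y_a y_{a+1} ⋯ y_b`. -/
noncomputable def yUp (g a b : ℕ) : SurfAlg K g :=
  ((List.range' a (b + 1 - a)).map (yg K g)).prod

/-- The descending word `y_b y_{b-1} ⋯ y_a`. -/
noncomputable def yDown (g a b : ℕ) : SurfAlg K g :=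
  ((List.range' a (b + 1 - a)).reverse.map (yg K g)).prod

/-- The generating set of the ideal `I` of the surface group with respect to the
presentation `⟨c_1, …, c_{2g} ∣ c_1⋯c_{2g} = c_{2g}⋯c_1⟩`:
it consists of `x_1x_2⋯x_{2g} − x_{2g}⋯x_1` and `x_iy_i − 1`, `y_ix_i − 1` for
`i = 1, …, 2g`. -/
noncomputable def surfIdealGens (g : ℕ) : Set (SurfAlg K g) :=
  {xUp K g 1 (2 * g) - xDown K g 1 (2 * g)} ∪
    {p | ∃ i, 1 ≤ i ∧ i ≤ 2 * g ∧ p = xg K g i * yg K g i - 1} ∪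
    {p | ∃ i, 1 ≤ i ∧ i ≤ 2 * g ∧ p = yg K g i * xg K g i - 1}

/-- The two-sided ideal `I` of the surface group `π₁(F_g)` with respect to the
presentation `⟨c_1, …, c_{2g} ∣ c_1⋯c_{2g} = c_{2g}⋯c_1⟩`. -/
noncomputable def surfIdeal (g : ℕ) : TwoSidedIdeal (SurfAlg K g) :=
  TwoSidedIdeal.span (surfIdealGens K g)

/-- The Gröbner–Shirshov basis `D` of the surface group ideal, consisting of the eight
families of polynomials (1)–(8). -/
noncomputable def DBasis (g : ℕ) : Set (SurfAlg K g) :=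
  {p | ∃ j s, 2 ≤ j ∧ j ≤ 2 * g ∧ 1 ≤ s ∧
      p = xg K g j * (xDown K g 1 (j - 1) * yDown K g (j + 1) (2 * g)) ^ s * yg K g j -
            (yUp K g (j + 1) (2 * g) * xUp K g 1 (j - 1)) ^ s} ∪
  {p | ∃ j s, 2 ≤ j ∧ j ≤ 2 * g ∧ 1 ≤ s ∧
      p = xg K g j * (xUp K g (j + 1) (2 * g) * yUp K g 1 (j - 1)) ^ s * yg K g j -
            (yDown K g 1 (j - 1) * xDown K g (j + 1) (2 * g)) ^ s} ∪
  {yDown K g 1 (2 * g) - yUp K g 1 (2 * g)} ∪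
  {xUp K g 1 (2 * g) - xDown K g 1 (2 * g)} ∪
  {p | ∃ i, 2 ≤ i ∧ i ≤ 2 * g ∧
      p = yUp K g i (2 * g) * xUp K g 1 (i - 1) -
            xDown K g 1 (i - 1) * yDown K g i (2 * g)} ∪
  {p | ∃ i, 2 ≤ i ∧ i ≤ 2 * g ∧
      p = yDown K g 1 (i - 1) * xDown K g i (2 * g) -
            xUp K g i (2 * g) * yUp K g 1 (i - 1)} ∪
  {p | ∃ i, 1 ≤ i ∧ i ≤ 2 * g ∧ p = yg K g i * xg K g i - 1} ∪
  {p | ∃ i, 1 ≤ i ∧ i ≤ 2 * g ∧ p = xg K g i * yg K g i - 1}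

/-- The product `u_a u_{a+1} ⋯ u_b`. -/
def prodUp {M : Type*} [Monoid M] (u : ℕ → M) (a b : ℕ) : M :=
  ((List.range' a (b + 1 - a)).map u).prod

/-- The product `u_b u_{b-1} ⋯ u_a`. -/
def prodDown {M : Type*} [Monoid M] (u : ℕ → M) (a b : ℕ) : M :=
  ((List.range' a (b + 1 - a)).reverse.map u).prod

section Monoid

variable {M N : Type*} [Monoid M] [Monoid N]

theorem map_prodUp (f : M →* N) (u : ℕ → M) (a b : ℕ) :
    f (prodUp u a b) = prodUp (fun i => f (u i)) a b := by
  simp [prodUp, map_list_prod, Function.comp_def]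

theorem map_prodDown (f : M →* N) (u : ℕ → M) (a b : ℕ) :
    f (prodDown u a b) = prodDown (fun i => f (u i)) a b := by
  simp [prodDown, map_list_prod, Function.comp_def]

theorem prodUp_congr {u v : ℕ → M} {a b : ℕ} (h : ∀ i, a ≤ i → i ≤ b → u i = v i) :
    prodUp u a b = prodUp v a b := by
  unfold prodUp
  congr 1
  refine List.map_congr_left fun i hi => ?_
  rw [List.mem_range'_1] at hi
  exact h i hi.1 (by omega)

theorem prodDown_congr {u v : ℕ → M} {a b : ℕ} (h : ∀ i, a ≤ i → i ≤ b → u i = v i) :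
    prodDown u a b = prodDown v a b := by
  unfold prodDown
  congr 1
  refine List.map_congr_left fun i hi => ?_
  rw [List.mem_reverse, List.mem_range'_1] at hi
  exact h i hi.1 (by omega)

theorem range'_split {i n : ℕ} (hi : 1 ≤ i) (hn : i ≤ n) :
    List.range' 1 (n + 1 - 1) =
      List.range' 1 (i - 1 + 1 - 1) ++ List.range' i (n + 1 - i) := by
  rw [show List.range' i (n + 1 - i) = List.range' (1 + (i - 1 + 1 - 1)) (n + 1 - i) by
    congr 1; omega, List.range'_append_1]
  congr 1; omega

theorem range'_split_head {j n : ℕ} (hn : j ≤ n) :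
    List.range' j (n + 1 - j) = j :: List.range' (j + 1) (n + 1 - (j + 1)) := by
  rw [show n + 1 - j = (n + 1 - (j + 1)) + 1 by omega, List.range'_succ]

theorem prodUp_split (u : ℕ → M) {i n : ℕ} (hi : 1 ≤ i) (hn : i ≤ n) :
    prodUp u 1 n = prodUp u 1 (i - 1) * prodUp u i n := by
  simp only [prodUp, range'_split hi hn, List.map_append, List.prod_append]

theorem prodDown_split (u : ℕ → M) {i n : ℕ} (hi : 1 ≤ i) (hn : i ≤ n) :
    prodDown u 1 n = prodDown u i n * prodDown u 1 (i - 1) := by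
  simp only [prodDown, range'_split hi hn, List.reverse_append, List.map_append,
    List.prod_append]

theorem prodUp_eq_mul (u : ℕ → M) {j n : ℕ} (hn : j ≤ n) :
    prodUp u j n = u j * prodUp u (j + 1) n := by
  simp only [prodUp, range'_split_head hn, List.map_cons, List.prod_cons]

theorem prodDown_eq_mul (u : ℕ → M) {j n : ℕ} (hn : j ≤ n) :
    prodDown u j n = prodDown u (j + 1) n * u j := by
  simp [prodDown, range'_split_head hn]

end Monoid

section Group

variable {G : Type*} [Group G]

theorem prodUp_inv (u : ℕ → G) (a b : ℕ) :
    prodUp (fun i => (u i)⁻¹) a b = (prodDown u a b)⁻¹ := by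
  simp [prodUp, prodDown, List.prod_inv_reverse, Function.comp_def]

theorem prodDown_inv (u : ℕ → G) (a b : ℕ) :
    prodDown (fun i => (u i)⁻¹) a b = (prodUp u a b)⁻¹ := by
  simp [prodUp, prodDown, List.prod_inv_reverse, Function.comp_def]

theorem conj_pow_of_conj {c a b : G} (h : c * a * c⁻¹ = b) (s : ℕ) :
    c * a ^ s * c⁻¹ = b ^ s := by
  rw [← h, conj_pow]

theorem prodDown_mul_inv_prodUp_conj {u : ℕ → G} {n j : ℕ}
    (h : prodUp u 1 n = prodDown u 1 n) (hj : 1 ≤ j) (hn : j ≤ n) :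
    u j * (prodDown u 1 (j - 1) * (prodUp u (j + 1) n)⁻¹) * (u j)⁻¹ =
      (prodDown u (j + 1) n)⁻¹ * prodUp u 1 (j - 1) := by
  rw [prodUp_split u hj hn, prodDown_split u hj hn, prodUp_eq_mul u hn,
    prodDown_eq_mul u hn] at h
  rw [eq_inv_mul_iff_mul_eq, ← mul_assoc, ← mul_assoc, ← mul_assoc, ← h]
  group

theorem prodUp_mul_inv_prodDown_conj {u : ℕ → G} {n j : ℕ}
    (h : prodUp u 1 n = prodDown u 1 n) (hj : 1 ≤ j) (hn : j ≤ n) :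
    u j * (prodUp u (j + 1) n * (prodDown u 1 (j - 1))⁻¹) * (u j)⁻¹ =
      (prodUp u 1 (j - 1))⁻¹ * prodDown u (j + 1) n := by
  rw [prodUp_split u hj hn, prodDown_split u hj hn, prodUp_eq_mul u hn,
    prodDown_eq_mul u hn] at h
  rw [eq_inv_mul_iff_mul_eq, ← mul_assoc, ← mul_assoc, ← mul_assoc, mul_assoc (prodUp u 1 (j - 1)),
    h]
  group

theorem inv_prodDown_mul_prodUp {u : ℕ → G} {n i : ℕ}
    (h : prodUp u 1 n = prodDown u 1 n) (hi : 1 ≤ i) (hn : i ≤ n) :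
    (prodDown u i n)⁻¹ * prodUp u 1 (i - 1) = prodDown u 1 (i - 1) * (prodUp u i n)⁻¹ := by
  rw [prodUp_split u hi hn, prodDown_split u hi hn] at h
  rw [inv_mul_eq_iff_eq_mul, ← mul_assoc, eq_mul_inv_iff_mul_eq, h]

theorem inv_prodUp_mul_prodDown {u : ℕ → G} {n i : ℕ}
    (h : prodUp u 1 n = prodDown u 1 n) (hi : 1 ≤ i) (hn : i ≤ n) :
    (prodUp u 1 (i - 1))⁻¹ * prodDown u i n = prodUp u i n * (prodDown u 1 (i - 1))⁻¹ := by
  rw [prodUp_split u hi hn, prodDown_split u hi hn] at h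
  rw [inv_mul_eq_iff_eq_mul, ← mul_assoc, eq_mul_inv_iff_mul_eq, h]

end Group

theorem TwoSidedIdeal.sub_mem_iff_mk'_eq {R : Type*} [Ring R] (I : TwoSidedIdeal R) (p q : R) :
    p - q ∈ I ↔ I.ringCon.mk' p = I.ringCon.mk' q := by
  rw [← I.rel_iff]
  exact (RingCon.eq I.ringCon).symm

/-- Any ring homomorphism out of `SurfAlg K g` that respects the defining relations of the
surface group identifies the two terms of each binomial in `DBasis K g`. -/
theorem DBasis_subset_ker (g : ℕ) {R : Type*} [Ring R] (φ : SurfAlg K g →+* R)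
    (hrel : φ (xUp K g 1 (2 * g)) = φ (xDown K g 1 (2 * g)))
    (hxy : ∀ i, 1 ≤ i → i ≤ 2 * g → φ (xg K g i) * φ (yg K g i) = 1)
    (hyx : ∀ i, 1 ≤ i → i ≤ 2 * g → φ (yg K g i) * φ (xg K g i) = 1)
    {p : SurfAlg K g} (hp : p ∈ DBasis K g) : φ p = 0 := by
  obtain ⟨u, hu, hv⟩ : ∃ u : ℕ → Rˣ,
      (∀ i, 1 ≤ i → i ≤ 2 * g → φ (xg K g i) = (u i : R)) ∧
      (∀ i, 1 ≤ i → i ≤ 2 * g → φ (yg K g i) = ((u i)⁻¹ : Rˣ)) := by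
    refine ⟨fun i => if hi : 1 ≤ i ∧ i ≤ 2 * g then
      ⟨φ (xg K g i), φ (yg K g i), hxy i hi.1 hi.2, hyx i hi.1 hi.2⟩ else 1, ?_, ?_⟩ <;>
    · intro i h1 h2
      simp [h1, h2]
  have hxU : ∀ a b, 1 ≤ a → b ≤ 2 * g → φ (xUp K g a b) = (prodUp u a b : Rˣ) := by
    intro a b ha hb
    refine ((map_prodUp (φ : SurfAlg K g →* R) _ a b).trans ?_).trans
      (map_prodUp (Units.coeHom R) u a b).symm
    exact prodUp_congr fun i h1 h2 => hu i (by omega) (by omega)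
  have hxD : ∀ a b, 1 ≤ a → b ≤ 2 * g → φ (xDown K g a b) = (prodDown u a b : Rˣ) := by
    intro a b ha hb
    refine ((map_prodDown (φ : SurfAlg K g →* R) _ a b).trans ?_).trans
      (map_prodDown (Units.coeHom R) u a b).symm
    exact prodDown_congr fun i h1 h2 => hu i (by omega) (by omega)
  have hyU : ∀ a b, 1 ≤ a → b ≤ 2 * g → φ (yUp K g a b) = ((prodDown u a b)⁻¹ : Rˣ) := by
    intro a b ha hb
    rw [← prodUp_inv]
    refine ((map_prodUp (φ : SurfAlg K g →* R) _ a b).trans ?_).trans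
      (map_prodUp (Units.coeHom R) _ a b).symm
    exact prodUp_congr fun i h1 h2 => hv i (by omega) (by omega)
  have hyD : ∀ a b, 1 ≤ a → b ≤ 2 * g → φ (yDown K g a b) = ((prodUp u a b)⁻¹ : Rˣ) := by
    intro a b ha hb
    rw [← prodDown_inv]
    refine ((map_prodDown (φ : SurfAlg K g →* R) _ a b).trans ?_).trans
      (map_prodDown (Units.coeHom R) _ a b).symm
    exact prodDown_congr fun i h1 h2 => hv i (by omega) (by omega)
  have h : prodUp u 1 (2 * g) = prodDown u 1 (2 * g) := by
    rw [hxU _ _ le_rfl le_rfl, hxD _ _ le_rfl le_rfl] at hrel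
    exact Units.ext hrel
  rcases hp with
    ((((((⟨j, s, h2, hj, -, rfl⟩ | ⟨j, s, h2, hj, -, rfl⟩) | rfl) | rfl) |
      ⟨i, h2, hi, rfl⟩) | ⟨i, h2, hi, rfl⟩) | ⟨i, h1, hi, rfl⟩) | ⟨i, h1, hi, rfl⟩ <;>
    rw [map_sub, sub_eq_zero]
  · simp only [map_mul, map_pow]
    rw [hu j (by omega) hj, hv j (by omega) hj, hxD _ _ (by omega) (by omega),
      hyD _ _ (by omega) (by omega), hyU _ _ (by omega) (by omega), hxU _ _ (by omega) (by omega)]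
    exact_mod_cast congrArg Units.val
      (conj_pow_of_conj (prodDown_mul_inv_prodUp_conj h (by omega) hj) s)
  · simp only [map_mul, map_pow]
    rw [hu j (by omega) hj, hv j (by omega) hj, hxD _ _ (by omega) (by omega),
      hyD _ _ (by omega) (by omega), hyU _ _ (by omega) (by omega), hxU _ _ (by omega) (by omega)]
    exact_mod_cast congrArg Units.val
      (conj_pow_of_conj (prodUp_mul_inv_prodDown_conj h (by omega) hj) s)
  · rw [hyD _ _ le_rfl le_rfl, hyU _ _ le_rfl le_rfl, h]
  · exact hrel
  · simp only [map_mul]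
    rw [hxD _ _ (by omega) (by omega), hyD _ _ (by omega) (by omega),
      hyU _ _ (by omega) (by omega), hxU _ _ (by omega) (by omega)]
    exact_mod_cast congrArg Units.val (inv_prodDown_mul_prodUp h (by omega) hi)
  · simp only [map_mul]
    rw [hxD _ _ (by omega) (by omega), hyD _ _ (by omega) (by omega),
      hyU _ _ (by omega) (by omega), hxU _ _ (by omega) (by omega)]
    exact_mod_cast congrArg Units.val (inv_prodUp_mul_prodDown h (by omega) hi)
  · rw [map_mul, map_one, hyx i h1 hi]
  · rw [map_mul, map_one, hxy i h1 hi]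

theorem surfIdealGens_subset_DBasis (g : ℕ) : surfIdealGens K g ⊆ DBasis K g := by
  rintro p ((hp | hp) | hp)
  · exact .inl (.inl (.inl (.inl (.inr hp))))
  · exact .inr hp
  · exact .inl (.inr hp)

/-- For `g ≥ 2`, the two-sided ideal of `A = K⟨x_1, y_1, …, x_{2g}, y_{2g}⟩` generated by
the Gröbner–Shirshov basis `D` equals the surface group ideal `I`. -/
theorem statement_5 (g : ℕ) (hg : 2 ≤ g) :
    TwoSidedIdeal.span (DBasis K g) = surfIdeal K g := by
  refine le_antisymm (TwoSidedIdeal.span_le.2 fun p hp => ?_)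
    (TwoSidedIdeal.span_mono (surfIdealGens_subset_DBasis K g))
  have hgen : ∀ q r, q - r ∈ surfIdealGens K g →
      (surfIdeal K g).ringCon.mk' q = (surfIdeal K g).ringCon.mk' r := fun q r hqr =>
    ((surfIdeal K g).sub_mem_iff_mk'_eq q r).1 (TwoSidedIdeal.subset_span hqr)
  have hφ : (surfIdeal K g).ringCon.mk' p = 0 := by
    refine DBasis_subset_ker K g _ (hgen _ _ (.inl (.inl rfl))) (fun i h1 hi => ?_)
      (fun i h1 hi => ?_) hp
    · rw [← map_mul, hgen _ 1 (.inl (.inr ⟨i, h1, hi, rfl⟩)), map_one]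
    · rw [← map_mul, hgen _ 1 (.inr ⟨i, h1, hi, rfl⟩), map_one]
  rw [SetLike.mem_coe, ← sub_zero p, TwoSidedIdeal.sub_mem_iff_mk'_eq, hφ, map_zero]
end
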